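/- The abelian complexity function of the infinite binary word q = g(p) takes only values in {1, 2, 3, 4}, and each of the values 1, 2, 3, 4 is attained for some n. -/

import Mathlib

/-- The finite block of length `n` occurring at position `i` in the infinite word `x`. -/
def FactorAt {A : Type*} (x : ℕ → A) (i n : ℕ) : List A :=
  (List.range n).map fun t => x (i + t)

/-- `w` is a (finite) factor of the infinite word `x`. -/
def IsFactor {A : Type*} (x : ℕ → A) (w : List A) : Prop :=
  ∃ i, w = FactorAt x i w.length

/-- Factor complexity of an infinite word: the number of distinct factors of length `n`. -/
noncomputable def complexity {A : Type*} (x : ℕ → A) (n : ℕ) : ℕ :=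
  Set.ncard {w : List A | w.length = n ∧ IsFactor x w}

/-- Factor complexity of a finite word: the number of distinct factors of length `n`. -/
noncomputable def complexityF {A : Type*} (z : List A) (n : ℕ) : ℕ :=
  Set.ncard {w : List A | w.length = n ∧ w <:+: z}

/-- `p` is a period of the finite word `y`:  `1 ≤ p ≤ |y|` and `y[j] = y[j+p]`
for all `0 ≤ j < |y| - p`. -/
def HasPeriod {A : Type*} [Inhabited A] (y : List A) (p : ℕ) : Prop :=
  1 ≤ p ∧ p ≤ y.length ∧ ∀ j, j + p < y.length → y.getD j default = y.getD (j + p) default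

/-- The smallest period of a finite word. -/
noncomputable def minPeriod {A : Type*} [Inhabited A] (y : List A) : ℕ :=
  sInf {p | HasPeriod y p}

/-- The exponent of a finite word: its length divided by its smallest period. -/
noncomputable def exponent {A : Type*} [Inhabited A] (y : List A) : ℚ :=
  (y.length : ℚ) / (minPeriod y : ℚ)

/-- The critical exponent of an infinite word: the supremum of the exponents of its
nonempty finite factors. -/
noncomputable def criticalExponent {A : Type*} [Inhabited A] (x : ℕ → A) : ENNReal :=
  sSup {e : ENNReal | ∃ w, IsFactor x w ∧ w ≠ [] ∧ e = ENNReal.ofReal ((exponent w : ℚ) : ℝ)}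

/-- The image of a finite word under a morphism given by its action on letters. -/
def mapWord {k : ℕ} {A : Type*} (σ : Fin k → List A) (w : List (Fin k)) : List A :=
  (w.map σ).flatten

/-- The image of an infinite word under a (nonerasing) morphism given by its action on
letters: the `n`-th letter of the concatenation `σ (x 0) ++ σ (x 1) ++ ⋯`. -/
def applyMorph {k : ℕ} {A : Type*} [Inhabited A] (σ : Fin k → List A) (x : ℕ → Fin k) :
    ℕ → A :=
  fun n => (((List.range (n + 1)).map fun i => σ (x i)).flatten).getD n default

/-- The morphism `h` with `h(0) = 01`, `h(1) = 21`, `h(2) = 0`. -/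
def hm : Fin 3 → List (Fin 3) := ![[0, 1], [2, 1], [0]]

/-- The morphism `g` with `g(0) = 011`, `g(1) = 0`, `g(2) = 01`. -/
def gm : Fin 3 → List (Fin 2) := ![[0, 1, 1], [0], [0, 1]]

/-- The abelian complexity of a binary infinite word at `n`: the number of distinct
values taken by the count of `0`'s among its length-`n` factors. -/
noncomputable def abelianComplexity (x : ℕ → Fin 2) (n : ℕ) : ℕ :=
  Set.ncard {z : ℕ | ∃ i, z = (FactorAt x i n).count 0}

section Prefixes

variable {A : Type*} {k : ℕ}

/-- The prefix of length `n` of an infinite word. -/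
def wordPrefix (x : ℕ → A) (n : ℕ) : List A :=
  (List.range n).map x

@[simp]
lemma length_wordPrefix (x : ℕ → A) (n : ℕ) : (wordPrefix x n).length = n := by
  simp [wordPrefix]

lemma wordPrefix_succ (x : ℕ → A) (n : ℕ) :
    wordPrefix x (n + 1) = wordPrefix x n ++ [x n] := by
  simp [wordPrefix, List.range_succ]

lemma wordPrefix_add (x : ℕ → A) (i n : ℕ) :
    wordPrefix x (i + n) = wordPrefix x i ++ FactorAt x i n := by
  simp [wordPrefix, FactorAt, List.range_add, Function.comp_def]

lemma wordPrefix_isPrefix (x : ℕ → A) {m n : ℕ} (h : m ≤ n) :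
    wordPrefix x m <+: wordPrefix x n := by
  obtain ⟨d, rfl⟩ := Nat.exists_eq_add_of_le h
  exact wordPrefix_add x m d ▸ List.prefix_append _ _

lemma mapWord_append (σ : Fin k → List A) (u v : List (Fin k)) :
    mapWord σ (u ++ v) = mapWord σ u ++ mapWord σ v := by
  simp [mapWord]

lemma mapWord_wordPrefix_succ (σ : Fin k → List A) (x : ℕ → Fin k) (n : ℕ) :
    mapWord σ (wordPrefix x (n + 1)) = mapWord σ (wordPrefix x n) ++ σ (x n) := by
  rw [wordPrefix_succ, mapWord_append]
  simp [mapWord]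

lemma mapWord_isPrefix (σ : Fin k → List A) {u v : List (Fin k)} (h : u <+: v) :
    mapWord σ u <+: mapWord σ v := by
  obtain ⟨t, rfl⟩ := h
  exact mapWord_append σ u t ▸ List.prefix_append _ _

lemma le_length_mapWord_wordPrefix {σ : Fin k → List A} (hσ : ∀ a, σ a ≠ [])
    (x : ℕ → Fin k) (n : ℕ) : n ≤ (mapWord σ (wordPrefix x n)).length := by
  induction n with
  | zero => simp
  | succ n ih =>
    have := List.length_pos_iff.2 (hσ (x n))
    rw [mapWord_wordPrefix_succ, List.length_append]
    omega

variable [Inhabited A]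

/-- A nonerasing morphism maps prefixes of `x` to prefixes of the image of `x`. -/
lemma wordPrefix_applyMorph {σ : Fin k → List A} (hσ : ∀ a, σ a ≠ []) (x : ℕ → Fin k)
    (n : ℕ) : wordPrefix (applyMorph σ x) (mapWord σ (wordPrefix x n)).length =
      mapWord σ (wordPrefix x n) := by
  refine List.ext_getElem (by simp) fun i h₁ h₂ => ?_
  have h₃ : i < (mapWord σ (wordPrefix x (i + 1))).length :=
    le_length_mapWord_wordPrefix hσ x (i + 1)
  have h₄ : applyMorph σ x i = (mapWord σ (wordPrefix x (i + 1)))[i] := by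
    rw [← List.getD_eq_getElem _ default h₃]
    simp [applyMorph, mapWord, wordPrefix, Function.comp_def]
  have h₅ : (wordPrefix (applyMorph σ x) (mapWord σ (wordPrefix x n)).length)[i] =
      applyMorph σ x i := by
    simp [wordPrefix]
  rw [h₅, h₄]
  rcases le_total (i + 1) n with h | h
  · exact (mapWord_isPrefix σ (wordPrefix_isPrefix x h)).getElem h₃
  · exact ((mapWord_isPrefix σ (wordPrefix_isPrefix x h)).getElem h₂).symm

/-- Every position of the image word lies in the image of a single letter. -/
lemma exists_block {σ : Fin k → List A} (hσ : ∀ a, σ a ≠ []) (x : ℕ → Fin k) (m : ℕ) :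
    ∃ n o, ∃ ho : o < (σ (x n)).length,
      m = (mapWord σ (wordPrefix x n)).length + o ∧
      wordPrefix (applyMorph σ x) m = mapWord σ (wordPrefix x n) ++ (σ (x n)).take o ∧
      applyMorph σ x m = (σ (x n))[o] := by
  obtain ⟨n, o, ho, rfl⟩ : ∃ n o, o < (σ (x n)).length ∧
      m = (mapWord σ (wordPrefix x n)).length + o := by
    induction m with
    | zero => exact ⟨0, 0, List.length_pos_iff.2 (hσ _), by simp [wordPrefix, mapWord]⟩
    | succ m ih =>
      obtain ⟨n, o, ho, rfl⟩ := ih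
      by_cases h : o + 1 < (σ (x n)).length
      · exact ⟨n, o + 1, h, by omega⟩
      · refine ⟨n + 1, 0, List.length_pos_iff.2 (hσ _), ?_⟩
        rw [mapWord_wordPrefix_succ, List.length_append]
        omega
  have hpre := wordPrefix_applyMorph hσ x (n + 1)
  rw [mapWord_wordPrefix_succ, List.length_append] at hpre
  refine ⟨n, o, ho, rfl, ?_, ?_⟩
  · have h := (wordPrefix_isPrefix (applyMorph σ x)
      (Nat.add_le_add_left ho.le (mapWord σ (wordPrefix x n)).length))
    rw [hpre, List.prefix_iff_eq_take, length_wordPrefix] at h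
    rw [h, List.take_length_add_append]
  · have h := (wordPrefix_isPrefix (applyMorph σ x)
      (Nat.add_le_add_left (Nat.succ_le_of_lt ho) (mapWord σ (wordPrefix x n)).length))
    rw [hpre] at h
    have h₁ := h.getElem (i := (mapWord σ (wordPrefix x n)).length + o) (by simp)
    rw [List.getElem_append_right (by omega)] at h₁
    simpa [wordPrefix] using h₁

end Prefixes

section Weights

variable {A : Type*} {k : ℕ}

/-- The total weight of a word whose letters carry real weights. -/
def wordWeight (r : A → ℝ) (w : List A) : ℝ :=
  (w.map r).sum

@[simp]
lemma wordWeight_nil (r : A → ℝ) : wordWeight r [] = 0 := rfl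

@[simp]
lemma wordWeight_cons (r : A → ℝ) (a : A) (w : List A) :
    wordWeight r (a :: w) = r a + wordWeight r w := by
  simp [wordWeight]

@[simp]
lemma wordWeight_append (r : A → ℝ) (u v : List A) :
    wordWeight r (u ++ v) = wordWeight r u + wordWeight r v := by
  simp [wordWeight]

lemma wordWeight_mapWord (r : A → ℝ) (σ : Fin k → List A) (w : List (Fin k)) :
    wordWeight r (mapWord σ w) = wordWeight (fun a => wordWeight r (σ a)) w := by
  induction w with
  | nil => simp [mapWord]
  | cons a w ih => rw [wordWeight_cons, ← ih]; simp [mapWord]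

/-- The letter weights on `{0, 1, 2}` obtained from the discrepancy of `0` with respect to the
frequency `α` by pulling back along `g` and then `j` times along `h`. -/
def pullbackWeight (α : ℝ) : ℕ → Fin 3 → ℝ
  | 0 => fun a => wordWeight ![1 - α, -α] (gm a)
  | j + 1 => fun a => wordWeight (pullbackWeight α j) (hm a)

lemma pullbackWeight_zero (α : ℝ) :
    pullbackWeight α 0 0 = 1 - 3 * α ∧ pullbackWeight α 0 1 = 1 - α ∧
      pullbackWeight α 0 2 = 1 - 2 * α := by
  refine ⟨?_, ?_, ?_⟩ <;> simp [pullbackWeight, gm] <;> ring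

lemma pullbackWeight_succ (α : ℝ) (j : ℕ) :
    pullbackWeight α (j + 1) 0 = pullbackWeight α j 0 + pullbackWeight α j 1 ∧
      pullbackWeight α (j + 1) 1 = pullbackWeight α j 2 + pullbackWeight α j 1 ∧
      pullbackWeight α (j + 1) 2 = pullbackWeight α j 0 := by
  simp [pullbackWeight, hm]

/-- When `α` is the frequency of `0`, the weights are annihilated by the dominant eigenvector,
so they satisfy the linear recurrence of the two remaining eigenvalues. -/
lemma pullbackWeight_add_two {θ : ℝ} (hθ : θ ^ 3 = 2 * θ ^ 2 - θ + 1) (j : ℕ) (a : Fin 3) :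
    pullbackWeight ((-2 + 5 * θ - θ ^ 2) / 7) (j + 2) a =
      (2 - θ) * pullbackWeight ((-2 + 5 * θ - θ ^ 2) / 7) (j + 1) a -
        (θ ^ 2 - 2 * θ + 1) * pullbackWeight ((-2 + 5 * θ - θ ^ 2) / 7) j a := by
  induction j generalizing a with
  | zero =>
    obtain ⟨h₀, h₁, h₂⟩ := pullbackWeight_zero ((-2 + 5 * θ - θ ^ 2) / 7)
    obtain ⟨k₀, k₁, k₂⟩ := pullbackWeight_succ ((-2 + 5 * θ - θ ^ 2) / 7) 0
    obtain ⟨l₀, l₁, l₂⟩ := pullbackWeight_succ ((-2 + 5 * θ - θ ^ 2) / 7) 1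
    fin_cases a <;> simp only [Fin.zero_eta, Fin.mk_one, Fin.reduceFinMk, zero_add] at * <;> grind
  | succ j ih =>
    obtain ⟨k₀, k₁, k₂⟩ := pullbackWeight_succ ((-2 + 5 * θ - θ ^ 2) / 7) j
    obtain ⟨l₀, l₁, l₂⟩ := pullbackWeight_succ ((-2 + 5 * θ - θ ^ 2) / 7) (j + 1)
    obtain ⟨m₀, m₁, m₂⟩ := pullbackWeight_succ ((-2 + 5 * θ - θ ^ 2) / 7) (j + 2)
    have i₀ := ih 0
    have i₁ := ih 1
    have i₂ := ih 2
    fin_cases a <;> simp only [Fin.zero_eta, Fin.mk_one, Fin.reduceFinMk] at *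
    · linear_combination m₀ - (2 - θ) * l₀ + (θ ^ 2 - 2 * θ + 1) * k₀ + i₀ + i₁
    · linear_combination m₁ - (2 - θ) * l₁ + (θ ^ 2 - 2 * θ + 1) * k₁ + i₂ + i₁
    · linear_combination m₂ - (2 - θ) * l₂ + (θ ^ 2 - 2 * θ + 1) * k₂ + i₀

lemma wordWeight_linear_combination {r r₁ r₂ : A → ℝ} {s t : ℝ}
    (h : ∀ a, r a = s * r₁ a - t * r₂ a) (w : List A) :
    wordWeight r w = s * wordWeight r₁ w - t * wordWeight r₂ w := by
  induction w with
  | nil => simp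
  | cons a w ih => simp only [wordWeight_cons, h, ih]; ring

end Weights

/-- Lower bounds, in multiples of `1 / 500`, for the pulled back discrepancies of a prefix of
`p`, indexed by the letter that follows the prefix. -/
def lowerBound : Fin 3 → Fin 6 → ℝ :=
  ![![-170, -170, -170, -170, -100, -93], ![-462, -379, -87, -31, -164, -170],
    ![-379, -87, -31, -164, -170, -100]]

/-- Upper bounds, in multiples of `1 / 500`, for the pulled back discrepancies of a prefix of
`p`, indexed by the letter that follows the prefix. -/
def upperBound : Fin 3 → Fin 6 → ℝ :=
  ![![275, 255, 122, 122, 122, 122], ![40, 67, 275, 255, 102, 32],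
    ![67, 275, 255, 102, 32, 102]]

/-- The box of admissible pulled back discrepancies for prefixes followed by the letter `a`. -/
def InBox (a : Fin 3) (x : ℕ → ℝ) : Prop :=
  ∀ j : Fin 6, lowerBound a j ≤ 500 * x j ∧ 500 * x j ≤ upperBound a j

lemma inBox_step {θ : ℝ} (hθ : θ ^ 3 = 2 * θ ^ 2 - θ + 1) (hl : 1.754877 ≤ θ)
    (hu : θ ≤ 1.754878) {a : Fin 3} {x : ℕ → ℝ} (hx : InBox a x)
    (hrec : x 6 = (2 - θ) * x 5 - (θ ^ 2 - 2 * θ + 1) * x 4)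
    (o : ℕ) (ho : o < (hm a).length) :
    InBox (hm a)[o] fun j => x (j + 1) +
      wordWeight (pullbackWeight ((-2 + 5 * θ - θ ^ 2) / 7) j) ((hm a).take o) := by
  obtain ⟨α, hα⟩ : ∃ α, α = (-2 + 5 * θ - θ ^ 2) / 7 := ⟨_, rfl⟩
  obtain ⟨t, ht⟩ : ∃ t, t = θ ^ 2 - 2 * θ + 1 := ⟨_, rfl⟩
  rw [← hα]
  rw [← ht] at hrec
  have hα₀ : 0.527827 ≤ α := by nlinarith
  have hα₁ : α ≤ 0.527828 := by nlinarith
  have ht₀ : 0.56983 ≤ t := by nlinarith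
  have ht₁ : t ≤ 0.56985 := by nlinarith
  have s₁ := mul_le_mul_of_nonneg_left (hx 5).1 (by linarith : 0 ≤ 2 - θ)
  have s₂ := mul_le_mul_of_nonneg_left (hx 5).2 (by linarith : 0 ≤ 2 - θ)
  have t₁ := mul_le_mul_of_nonneg_left (hx 4).1 (by linarith : 0 ≤ t)
  have t₂ := mul_le_mul_of_nonneg_left (hx 4).2 (by linarith : 0 ≤ t)
  have b₀ := hx 0
  have b₁ := hx 1
  have b₂ := hx 2
  have b₃ := hx 3
  have b₄ := hx 4
  have b₅ := hx 5
  obtain ⟨u₀, u₁, u₂⟩ := pullbackWeight_zero α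
  obtain ⟨v₀, v₁, v₂⟩ := pullbackWeight_succ α 0
  obtain ⟨w₀, w₁, w₂⟩ := pullbackWeight_succ α 1
  obtain ⟨y₀, y₁, y₂⟩ := pullbackWeight_succ α 2
  obtain ⟨z₀, z₁, z₂⟩ := pullbackWeight_succ α 3
  obtain ⟨c₀, c₁, c₂⟩ := pullbackWeight_succ α 4
  have ho₂ : o = 0 ∨ o = 1 ∧ a ≠ 2 := by fin_cases a <;> simp [hm] at ho ⊢ <;> omega
  clear hx
  rcases ho₂ with rfl | ⟨rfl, ha⟩ <;> fin_cases a <;>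
    simp [hm, lowerBound, upperBound] at * <;> intro j <;> fin_cases j <;>
    simp [lowerBound, upperBound] <;> constructor <;> linarith

lemma hm_ne_nil (a : Fin 3) : hm a ≠ [] := by
  fin_cases a <;> simp [hm]

lemma gm_ne_nil (a : Fin 3) : gm a ≠ [] := by
  fin_cases a <;> simp [gm]

lemma lt_length_mapWord_hm {p : ℕ → Fin 3} (hp0 : p 0 = 0) {n : ℕ} (hn : n ≠ 0) :
    n < (mapWord hm (wordPrefix p n)).length := by
  induction n with
  | zero => exact absurd rfl hn
  | succ n ih =>
    rw [mapWord_wordPrefix_succ, List.length_append]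
    rcases eq_or_ne n 0 with rfl | h
    · simp [hp0, hm]
    · have := List.length_pos_iff.2 (hm_ne_nil (p n))
      have := ih h
      omega

lemma inBox_prefix {θ : ℝ} (hθ : θ ^ 3 = 2 * θ ^ 2 - θ + 1) (hl : 1.754877 ≤ θ)
    (hu : θ ≤ 1.754878) {p : ℕ → Fin 3} (hp0 : p 0 = 0) (hpfix : applyMorph hm p = p)
    (m : ℕ) : InBox (p m) fun j =>
      wordWeight (pullbackWeight ((-2 + 5 * θ - θ ^ 2) / 7) j) (wordPrefix p m) := by
  induction m using Nat.strong_induction_on with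
  | _ m ih =>
    rcases eq_or_ne m 0 with rfl | hm₀
    · intro j
      rw [hp0]
      fin_cases j <;> simp [lowerBound, upperBound, wordPrefix]
    · obtain ⟨n, o, ho, hmn, hpre, hlet⟩ := exists_block hm_ne_nil p m
      rw [hpfix] at hpre hlet
      have hnm : n < m := by
        rcases eq_or_ne n 0 with rfl | h
        · omega
        · have := lt_length_mapWord_hm hp0 h
          omega
      have h := inBox_step hθ hl hu (ih n hnm)
        (wordWeight_linear_combination (pullbackWeight_add_two hθ 4) _) o ho
      rw [hlet, hpre]
      simp only [wordWeight_append, wordWeight_mapWord]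
      exact h

lemma wordWeight_eq_count (α : ℝ) (w : List (Fin 2)) :
    wordWeight ![1 - α, -α] w = w.count 0 - α * w.length := by
  induction w with
  | nil => simp
  | cons a w ih =>
    rw [wordWeight_cons, ih]
    fin_cases a <;> simp <;> ring

/-- The discrepancy of `0` over the prefixes of `q` stays in an interval of length less
than `2`. -/
lemma discrepancy_mem {θ : ℝ} (hθ : θ ^ 3 = 2 * θ ^ 2 - θ + 1) (hl : 1.754877 ≤ θ)
    (hu : θ ≤ 1.754878) {p : ℕ → Fin 3} (hp0 : p 0 = 0) (hpfix : applyMorph hm p = p)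
    (m : ℕ) : ((wordPrefix (applyMorph gm p) m).count 0 : ℝ) -
      (-2 + 5 * θ - θ ^ 2) / 7 * m ∈ Set.Icc (-0.93 : ℝ) 1.03 := by
  obtain ⟨n, o, ho, -, hpre, -⟩ := exists_block gm_ne_nil p m
  have h := inBox_prefix hθ hl hu hp0 hpfix n 0
  have hw := wordWeight_eq_count ((-2 + 5 * θ - θ ^ 2) / 7) (wordPrefix (applyMorph gm p) m)
  rw [length_wordPrefix] at hw
  rw [← hw, hpre, wordWeight_append, wordWeight_mapWord]
  change _ + _ ∈ _
  obtain ⟨α, hα⟩ : ∃ α, α = (-2 + 5 * θ - θ ^ 2) / 7 := ⟨_, rfl⟩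
  have hα₀ : 0.527827 ≤ α := by nlinarith
  have hα₁ : α ≤ 0.527828 := by nlinarith
  rw [← hα] at h ⊢
  change _ ≤ 500 * wordWeight (fun a => wordWeight ![1 - α, -α] (gm a)) (wordPrefix p n) ∧
    500 * wordWeight (fun a => wordWeight ![1 - α, -α] (gm a)) (wordPrefix p n) ≤ _ at h
  generalize wordWeight (fun a => wordWeight ![1 - α, -α] (gm a)) (wordPrefix p n) = y at h ⊢
  generalize p n = a at h ho
  have ho₃ : o < 3 := ho.trans_le (by fin_cases a <;> simp [gm])
  interval_cases o <;> fin_cases a <;> simp [gm, lowerBound, upperBound] at * <;>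
    constructor <;> linarith

lemma exists_dominant_root :
    ∃ θ : ℝ, θ ^ 3 = 2 * θ ^ 2 - θ + 1 ∧ 1.754877 ≤ θ ∧ θ ≤ 1.754878 := by
  obtain ⟨θ, ⟨hl, hu⟩, hθ⟩ := intermediate_value_Icc (a := (1.754877 : ℝ)) (b := 1.754878)
    (f := fun x => x ^ 3 - 2 * x ^ 2 + x - 1) (by norm_num) (by fun_prop)
    (show (0 : ℝ) ∈ _ by constructor <;> norm_num)
  exact ⟨θ, by linear_combination hθ, hl, hu⟩

lemma count_factorAt_le {p : ℕ → Fin 3} (hp0 : p 0 = 0) (hpfix : applyMorph hm p = p)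
    (n i j : ℕ) : (FactorAt (applyMorph gm p) i n).count 0 ≤
      (FactorAt (applyMorph gm p) j n).count 0 + 3 := by
  obtain ⟨θ, hθ, hl, hu⟩ := exists_dominant_root
  have key := discrepancy_mem hθ hl hu hp0 hpfix
  have h₁ := key (i + n)
  have h₂ := key i
  have h₃ := key (j + n)
  have h₄ := key j
  rw [wordPrefix_add, List.count_append] at h₁ h₃
  push_cast at h₁ h₃
  rw [Set.mem_Icc] at h₁ h₂ h₃ h₄
  have h : ((FactorAt (applyMorph gm p) i n).count 0 : ℝ) <
      (FactorAt (applyMorph gm p) j n).count 0 + 4 := by linarith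
  have h' : (FactorAt (applyMorph gm p) i n).count 0 <
      (FactorAt (applyMorph gm p) j n).count 0 + 4 := by exact_mod_cast h
  omega

/-- A nonempty set of naturals of diameter at most `d` has at least one and at most `d + 1`
elements. -/
lemma ncard_mem_Icc_of_forall_le_add {s : Set ℕ} (hs : s.Nonempty) {d : ℕ}
    (h : ∀ a ∈ s, ∀ b ∈ s, a ≤ b + d) : s.ncard ∈ Set.Icc 1 (d + 1) := by
  have hsub : s ⊆ Finset.Icc (sInf s) (sInf s + d) := fun a ha => by
    simpa using ⟨Nat.sInf_le ha, h a ha _ (Nat.sInf_mem hs)⟩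
  refine ⟨(Set.ncard_pos ((Finset.finite_toSet _).subset hsub)).2 hs, ?_⟩
  calc s.ncard ≤ _ := Set.ncard_le_ncard hsub (Finset.finite_toSet _)
    _ = d + 1 := by rw [Set.ncard_coe_finset, Nat.card_Icc]; omega

lemma wordPrefix_eq_iterate {p : ℕ → Fin 3} (hp0 : p 0 = 0) (hpfix : applyMorph hm p = p)
    (n : ℕ) : ((mapWord hm)^[n] [0]) = wordPrefix p ((mapWord hm)^[n] [0]).length := by
  induction n with
  | zero => simp [wordPrefix, hp0]
  | succ n ih =>
    have h := wordPrefix_applyMorph hm_ne_nil p ((mapWord hm)^[n] [0]).length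
    rw [hpfix, ← ih, ← Function.iterate_succ_apply' (mapWord hm)] at h
    exact h.symm

/-- Short factors of `q` can be read off a finite prefix. -/
lemma factorAt_eq {p : ℕ → Fin 3} (hp0 : p 0 = 0) (hpfix : applyMorph hm p = p) {i n : ℕ}
    (h : i + n ≤ (mapWord gm ((mapWord hm)^[6] [0])).length) :
    FactorAt (applyMorph gm p) i n =
      ((mapWord gm ((mapWord hm)^[6] [0])).drop i).take n := by
  have h₁ := wordPrefix_applyMorph gm_ne_nil p ((mapWord hm)^[6] [0]).length
  rw [← wordPrefix_eq_iterate hp0 hpfix] at h₁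
  have h₂ := wordPrefix_isPrefix (applyMorph gm p) h
  rw [h₁, wordPrefix_add] at h₂
  obtain ⟨t, ht⟩ := h₂
  have hi : (wordPrefix (applyMorph gm p) i).length = i := length_wordPrefix _ _
  have hn : (FactorAt (applyMorph gm p) i n).length = n := by simp [FactorAt]
  rw [← ht, List.append_assoc, List.drop_left' hi, List.take_left' hn]

/-- The abelian complexity of `q = g(p)` takes only the values `1`, `2`, `3`, `4`, and
each of these values is attained. -/
theorem stmt7 (p : ℕ → Fin 3) (hp0 : p 0 = 0) (hpfix : applyMorph hm p = p) :
    (∀ n : ℕ, abelianComplexity (applyMorph gm p) n ∈ ({1, 2, 3, 4} : Set ℕ)) ∧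
    (∀ v ∈ ({1, 2, 3, 4} : Set ℕ), ∃ n : ℕ, abelianComplexity (applyMorph gm p) n = v) := by
  have hne (n : ℕ) : {z | ∃ i, z = (FactorAt (applyMorph gm p) i n).count 0}.Nonempty :=
    ⟨_, 0, rfl⟩
  have hbound (n : ℕ) : abelianComplexity (applyMorph gm p) n ∈ Set.Icc 1 4 :=
    ncard_mem_Icc_of_forall_le_add (hne n) <| by
      rintro _ ⟨i, rfl⟩ _ ⟨j, rfl⟩
      exact count_factorAt_le hp0 hpfix n i j
  have hsmall (n : ℕ) : abelianComplexity (applyMorph gm p) n ∈ Set.Icc 1 (n + 1) :=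
    ncard_mem_Icc_of_forall_le_add (hne n) <| by
      rintro _ ⟨i, rfl⟩ _ ⟨j, rfl⟩
      have : (FactorAt (applyMorph gm p) i n).count 0 ≤ n :=
        List.count_le_length.trans (by simp [FactorAt])
      omega
  have hfin (n : ℕ) : {z | ∃ i, z = (FactorAt (applyMorph gm p) i n).count 0}.Finite :=
    Set.finite_of_ncard_pos (hbound n).1
  have hlower (n : ℕ) (s : Finset ℕ)
      (hs : ∀ z ∈ s, ∃ i, z = (FactorAt (applyMorph gm p) i n).count 0) :
      s.card ≤ abelianComplexity (applyMorph gm p) n := by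
    rw [← Set.ncard_coe_finset]
    exact Set.ncard_le_ncard hs (hfin n)
  have hcount {i n z : ℕ} (h : i + n ≤ (mapWord gm ((mapWord hm)^[6] [0])).length)
      (hz : z = (((mapWord gm ((mapWord hm)^[6] [0])).drop i).take n).count 0) :
      ∃ i, z = (FactorAt (applyMorph gm p) i n).count 0 :=
    ⟨i, by rw [factorAt_eq hp0 hpfix h, hz]⟩
  refine ⟨fun n => ?_, ?_⟩
  · have := hbound n
    simp only [Set.mem_Icc, Set.mem_insert_iff, Set.mem_singleton_iff] at this ⊢
    omega
  · rintro v (rfl | rfl | rfl | rfl)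
    · exact ⟨0, le_antisymm (hsmall 0).2 (hsmall 0).1⟩
    · refine ⟨1, le_antisymm (hsmall 1).2 (hlower 1 {0, 1} ?_)⟩
      simp only [Finset.mem_insert, Finset.mem_singleton]
      rintro z (rfl | rfl)
      · exact hcount (i := 1) (by decide) (by decide)
      · exact hcount (i := 0) (by decide) (by decide)
    · refine ⟨2, le_antisymm (hsmall 2).2 (hlower 2 {0, 1, 2} ?_)⟩
      simp only [Finset.mem_insert, Finset.mem_singleton]
      rintro z (rfl | rfl | rfl)
      · exact hcount (i := 1) (by decide) (by decide)
      · exact hcount (i := 0) (by decide) (by decide)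
      · exact hcount (i := 3) (by decide) (by decide)
    · refine ⟨18, le_antisymm (hbound 18).2 (hlower 18 {8, 9, 10, 11} ?_)⟩
      simp only [Finset.mem_insert, Finset.mem_singleton]
      rintro z (rfl | rfl | rfl | rfl)
      · exact hcount (i := 8) (by decide) (by decide)
      · exact hcount (i := 1) (by decide) (by decide)
      · exact hcount (i := 0) (by decide) (by decide)
      · exact hcount (i := 43) (by decide) (by decide)
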